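/- arXiv:1512.08695 — 2 statements merged into one kernel-verified Lean document; each statement's English description precedes it below -/
import Mathlib

section
/- Let (G,+) be a semimodule over a discrete semiring (R,+,·) and let φ : G × X → X be a topological dynamical system over a nonempty compact Hausdorff space X. Then there exists a point p ∈ X which is multiply syndetic nonwandering for φ; that is, for any T₁,…,T_l ∈ G and any open neighborhood U of p, the set N_{T₁,…,T_l}(U) = {t ∈ R : there exists x ∈ U with φ(t•Tᵢ, x) ∈ U for every i = 1,…,l} is syndetic in (R,+). -/
/-- A subset `N` of `(R,+)` is syndetic if there is a finite set `K ⊆ R` such that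
`(K + t) ∩ N ≠ ∅` for every `t ∈ R`. -/
def Syndetic {R : Type*} [Add R] (N : Set R) : Prop :=
  ∃ K : Finset R, ∀ t : R, ∃ k ∈ K, k + t ∈ N

/-- If `N` is not syndetic, its complement contains all nonempty subset sums of some family of
any prescribed finite length. -/
theorem exists_sum_notMem_of_not_syndetic {ι R : Type*} [DecidableEq ι] [AddCommMonoid R]
    {N : Set R} (hN : ¬ Syndetic N) (s : Finset ι) :
    ∃ t : ι → R, ∀ a ⊆ s, a.Nonempty → ∑ i ∈ a, t i ∉ N := by
  classical
  induction s using Finset.induction_on with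
  | empty =>
    exact ⟨0, fun a ha hne => absurd (Finset.subset_empty.1 ha) hne.ne_empty⟩
  | insert i s hi ih =>
    obtain ⟨t, ht⟩ := ih
    simp only [Syndetic, not_exists, not_forall, not_and] at hN
    obtain ⟨u, hu⟩ := hN (s.powerset.image fun a => ∑ j ∈ a, t j)
    refine ⟨Function.update t i u, fun a ha hne => ?_⟩
    by_cases hia : i ∈ a
    · rw [← Finset.sum_erase_add a _ hia, Function.update_self,
        Finset.sum_update_of_notMem (Finset.notMem_erase i a)]
      exact hu _ (Finset.mem_image_of_mem _
        (Finset.mem_powerset.2 (Finset.subset_insert_iff.1 ha)))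
    · rw [Finset.sum_update_of_notMem hia]
      exact ht a ((Finset.subset_insert_iff_of_notMem hia).1 ha) hne

/-- A syndetic form of Gallai's theorem: for a finite colouring of a semimodule, the dilation
factors of monochromatic homothetic copies of a finite family form a syndetic set. -/
theorem syndetic_setOf_mono_homothetic {R G α κ : Type*} [Semiring R] [AddCommMonoid G]
    [Module R G] [Finite α] [Finite κ] (T : α → G) (C : G → κ) :
    Syndetic {t : R | ∃ (g : G) (c : κ), ∀ i, C (g + t • T i) = c} := by
  classical
  by_contra hN
  obtain ⟨ι, _, hι⟩ := Combinatorics.Line.exists_mono_in_high_dimension α κ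
  obtain ⟨t, ht⟩ := exists_sum_notMem_of_not_syndetic hN (Finset.univ : Finset ι)
  obtain ⟨L, c, hc⟩ := hι fun w => C (∑ j, t j • T (w j))
  obtain ⟨j₀, hj₀⟩ := L.proper
  refine ht {j | L.idxFun j = none} (Finset.subset_univ _) ⟨j₀, by simpa using hj₀⟩
    ⟨∑ j with L.idxFun j ≠ none, t j • (L.idxFun j).elim 0 T, c, fun i => ?_⟩
  rw [← hc i, Finset.sum_smul, add_comm]
  beta_reduce
  rw [← Finset.sum_filter_add_sum_filter_not Finset.univ (fun j => L.idxFun j = none)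
      (fun j => t j • T (L i j))]
  congr 2
  · refine Finset.sum_congr rfl fun j hj => ?_
    rw [L.apply_none i j (Finset.mem_filter.1 hj).2]
  · refine Finset.sum_congr rfl fun j hj => ?_
    obtain ⟨x, hx⟩ := Option.ne_none_iff_exists'.1 (Finset.mem_filter.1 hj).2
    rw [L.apply_some hx, hx, Option.elim_some]

/-- A family of self-maps of a nonempty compact space has a minimal nonempty closed invariant
set. -/
theorem exists_minimal_closed_invariant {G X : Type*} [TopologicalSpace X] [CompactSpace X]
    [Nonempty X] (φ : G → X → X) :
    ∃ Y : Set X, Minimal (fun Y => IsClosed Y ∧ Y.Nonempty ∧ ∀ g, Set.MapsTo (φ g) Y Y) Y := by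
  refine zorn_superset {Y : Set X | IsClosed Y ∧ Y.Nonempty ∧ ∀ g, Set.MapsTo (φ g) Y Y}
    fun c hcS hc => ?_
  rcases c.eq_empty_or_nonempty with rfl | hne
  · exact ⟨Set.univ, ⟨isClosed_univ, Set.univ_nonempty, fun g => Set.mapsTo_univ _ _⟩, by simp⟩
  have : Nonempty c := hne.to_subtype
  refine ⟨⋂₀ c, ⟨isClosed_sInter fun s hs => (hcS hs).1, ?_, fun g x hx s hs =>
    (hcS hs).2.2 g (hx s hs)⟩, fun s hs => Set.sInter_subset_of_mem hs⟩
  exact IsCompact.nonempty_sInter_of_directed_nonempty_isCompact_isClosed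
    (fun a ha b hb => (hc.total ha hb).elim (fun h => ⟨a, ha, subset_rfl, h⟩)
      fun h => ⟨b, hb, h, subset_rfl⟩)
    (fun s hs => (hcS hs).2.1)
    (fun s hs => (hcS hs).1.isCompact) (fun s hs => (hcS hs).1)

/-- Every topological dynamical system `φ : G × X → X` of a semimodule `G` over a
discrete semiring `R` on a nonempty compact Hausdorff space `X` has a multiply syndetic
nonwandering point: a point `p` such that for any `T₁,…,T_l ∈ G` and any open
neighborhood `U` of `p`, the set `N_{T₁,…,T_l}(U)` is syndetic in `(R,+)`. -/
theorem exists_multiply_syndetic_nonwandering_point {R G X : Type*} [Semiring R]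
    [AddCommMonoid G] [Module R G] [TopologicalSpace X] [CompactSpace X] [T2Space X]
    [Nonempty X]
    (φ : G → X → X)
    (hid : ∀ x : X, φ 0 x = x)
    (hadd : ∀ g h : G, ∀ x : X, φ (g + h) x = φ g (φ h x))
    (hcont : ∀ g : G, Continuous (φ g)) :
    ∃ p : X, ∀ (l : ℕ) (T : Fin l → G) (U : Set X), IsOpen U → p ∈ U →
      Syndetic {t : R | ∃ x ∈ U, ∀ i : Fin l, φ (t • T i) x ∈ U} := by
  obtain ⟨Y, ⟨hYc, ⟨y, hy⟩, hYinv⟩, hmin⟩ := exists_minimal_closed_invariant φ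
  refine ⟨y, fun l T U hU hyU => ?_⟩
  have hreturn : Y ⊆ ⋃ g, φ g ⁻¹' U := by
    intro z hz
    have hsub : closure (Set.range fun g => φ g z) ⊆ Y :=
      closure_minimal (Set.range_subset_iff.2 fun g => hYinv g hz) hYc
    have hy' : y ∈ closure (Set.range fun g => φ g z) := by
      refine hmin ⟨isClosed_closure, (Set.range_nonempty _).closure, fun g => ?_⟩ hsub hy
      refine Set.MapsTo.closure ?_ (hcont g)
      rintro _ ⟨h, rfl⟩
      exact ⟨g + h, hadd g h z⟩
    obtain ⟨_, hgU, g, rfl⟩ := mem_closure_iff.1 hy' U hU hyU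
    exact Set.mem_iUnion.2 ⟨g, hgU⟩
  obtain ⟨F, hF⟩ := hYc.isCompact.elim_finite_subcover (fun g => φ g ⁻¹' U)
    (fun g => hU.preimage (hcont g)) hreturn
  have hcolor : ∀ g, ∃ f : F, φ f (φ g y) ∈ U := fun g => by
    simpa using hF (hYinv g hy)
  choose C hC using hcolor
  obtain ⟨K, hK⟩ := syndetic_setOf_mono_homothetic (R := R) (fun i : Option (Fin l) => i.elim 0 T) C
  refine ⟨K, fun t => ?_⟩
  obtain ⟨k, hk, g, c, hg⟩ := hK t
  refine ⟨k, hk, φ c (φ g y), ?_, fun i => ?_⟩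
  · have h := hC g
    rwa [show C g = c by simpa using hg none] at h
  · have h := hC (g + (k + t) • T i)
    rw [show C (g + (k + t) • T i) = c from hg (some i)] at h
    rwa [← hadd, ← hadd, add_assoc, add_comm, add_assoc, hadd]
end

section
/- Let X be a nonempty compact metric space and T : X → X a continuous map such that (X,T) is minimal (the only nonempty closed subset Y ⊆ X with T(Y) ⊆ Y is X itself) and the family of iterates {Tⁿ : n ∈ ℕ} is equicontinuous. Let ψ : X → ℝ/ℤ be continuous and define the skew product T_ψ : X × ℝ/ℤ → X × ℝ/ℤ by T_ψ(x,θ) = (Tx, θ + ψ(x)). Then either (X × ℝ/ℤ, T_ψ) is minimal, or the following hold: the family {T_ψⁿ : n ∈ ℕ} is equicontinuous, every point (x,θ) ∈ X × ℝ/ℤ is uniformly recurrent for T_ψ (hence Bohr almost periodic for T_ψ), and there exist a positive integer h and a continuous function ξ : X → ℝ/ℤ solving the cohomology equation h·ψ(x) = ξ(Tx) − ξ(x) for all x ∈ X. -/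
/-- A subset `N ⊆ ℕ` is syndetic if there is a finite set `K ⊆ ℕ` such that
`N ∩ (n + K) ≠ ∅` for every `n ∈ ℕ`. -/
def SyndeticNat (N : Set ℕ) : Prop :=
  ∃ K : Finset ℕ, ∀ n : ℕ, ∃ k ∈ K, n + k ∈ N

/-- The skew product (`𝕋`-extension) `T_ψ(x,θ) = (Tx, θ + ψ(x))`. -/
noncomputable def skewProd {X : Type*} (T : X → X) (ψ : X → AddCircle (1 : ℝ)) :
    X × AddCircle (1 : ℝ) → X × AddCircle (1 : ℝ) :=
  fun p => (T p.1, p.2 + ψ p.1)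

/-- `Y` is a nonempty closed set mapped into itself by `S`. -/
def IsClosedInvariant {Z : Type*} [TopologicalSpace Z] (S : Z → Z) (Y : Set Z) : Prop :=
  IsClosed Y ∧ Y.Nonempty ∧ Set.MapsTo S Y Y

/-- In a compact space, every nonempty closed invariant set contains a minimal one. -/
theorem IsClosedInvariant.exists_minimal_subset {Z : Type*} [TopologicalSpace Z] [CompactSpace Z]
    {S : Z → Z} {Y : Set Z} (hY : IsClosedInvariant S Y) :
    ∃ M ⊆ Y, Minimal (IsClosedInvariant S) M := by
  refine zorn_superset_nonempty {Y | IsClosedInvariant S Y} (fun c hc hchain hne => ?_) Y hY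
  have : Nonempty c := hne.to_subtype
  refine ⟨⋂₀ c, ⟨isClosed_sInter fun s hs => (hc hs).1, ?_, fun z hz s hs =>
    (hc hs).2.2 (hz s hs)⟩, fun s hs => Set.sInter_subset_of_mem hs⟩
  have directed : DirectedOn (· ⊇ ·) c := fun s hs t ht =>
    (hchain.total hs ht).elim (fun hst => ⟨s, hs, subset_rfl, hst⟩) fun hts =>
      ⟨t, ht, hts, subset_rfl⟩
  exact IsCompact.nonempty_sInter_of_directed_nonempty_isCompact_isClosed
    directed (fun s hs => (hc hs).2.1)
    (fun s hs => (hc hs).1.isCompact) (fun s hs => (hc hs).1)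

/-- Return times of a point of a minimal set to an open set meeting that set are syndetic. -/
theorem syndeticNat_of_minimal {Z : Type*} [TopologicalSpace Z] [CompactSpace Z]
    {S : Z → Z} (hS : Continuous S) {M U : Set Z} (hM : Minimal (IsClosedInvariant S) M)
    (hU : IsOpen U) (hMU : (M ∩ U).Nonempty) {z : Z} (hz : z ∈ M) :
    SyndeticNat {n : ℕ | S^[n] z ∈ U} := by
  have hcover : M ⊆ ⋃ n : ℕ, S^[n] ⁻¹' U := by
    by_contra hnot
    obtain ⟨y, hyM, hy⟩ := Set.not_subset.1 hnot
    have hA : IsClosedInvariant S (M ∩ (⋃ n : ℕ, S^[n] ⁻¹' U)ᶜ) := by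
      refine ⟨hM.prop.1.inter
        (isOpen_iUnion fun n => hU.preimage (hS.iterate n)).isClosed_compl, ⟨y, hyM, hy⟩,
        fun w hw => ⟨hM.prop.2.2 hw.1, fun hmem => hw.2 ?_⟩⟩
      obtain ⟨n, hn⟩ := Set.mem_iUnion.1 hmem
      exact Set.mem_iUnion.2 ⟨n + 1, hn⟩
    obtain ⟨w, hwM, hwU⟩ := hMU
    exact (hM.2 hA Set.inter_subset_left hwM).2 (Set.mem_iUnion.2 ⟨0, hwU⟩)
  obtain ⟨K, hK⟩ := hM.prop.1.isCompact.elim_finite_subcover _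
    (fun n => hU.preimage (hS.iterate n)) hcover
  refine ⟨K, fun n => ?_⟩
  obtain ⟨k, hk, hmem⟩ := Set.mem_iUnion₂.1 (hK ((hM.prop.2.2.iterate n) hz))
  refine ⟨k, hk, ?_⟩
  rwa [Set.mem_ofPred_eq, add_comm, Function.iterate_add_apply]

theorem AddCircle.norm_nsmul_eq_of_norm_le {h : ℕ} (hh : 0 < h) {u : AddCircle (1 : ℝ)}
    (hu : ‖u‖ ≤ 1 / (2 * h)) : ‖h • u‖ = h * ‖u‖ := by
  have hh' : (1 : ℝ) ≤ h := by exact_mod_cast hh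
  obtain ⟨t, rfl, ht⟩ : ∃ t : ℝ, (t : AddCircle (1 : ℝ)) = u ∧ |t| = ‖u‖ := by
    obtain ⟨t, rfl⟩ := QuotientAddGroup.mk_surjective u
    refine ⟨t - round t, ?_, ?_⟩
    · rw [AddCircle.coe_sub, sub_eq_self]
      exact (AddCircle.coe_eq_zero_iff 1).2 ⟨round t, by simp⟩
    · exact (UnitAddCircle.norm_eq (x := t)).symm
  rw [← ht] at hu ⊢
  have hmul : |(h : ℝ) * t| = h * |t| := by rw [abs_mul, Nat.abs_cast]
  rw [← AddCircle.coe_nsmul, nsmul_eq_mul, ← hmul,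
    AddCircle.norm_coe_eq_abs_iff 1 one_ne_zero, hmul, abs_one]
  calc (h : ℝ) * |t| ≤ h * (1 / (2 * h)) := by gcongr
    _ = 1 / 2 := by field_simp

/-- A proper closed subgroup of the circle is annihilated by a positive integer. -/
theorem AddCircle.exists_nsmul_eq_zero_of_isClosed {H : AddSubgroup (AddCircle (1 : ℝ))}
    (hcl : IsClosed (H : Set (AddCircle (1 : ℝ)))) (hH : H ≠ ⊤) :
    ∃ h : ℕ, 0 < h ∧ ∀ a ∈ H, h • a = 0 := by
  have hd : ¬ Dense (H : Set (AddCircle (1 : ℝ))) := fun hd =>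
    hH (SetLike.coe_injective (by rw [← hcl.closure_eq, hd.closure_eq, AddSubgroup.coe_top]))
  rw [AddCircle.dense_addSubgroup_iff_ne_zmultiples] at hd
  push Not at hd
  obtain ⟨a, ha, rfl⟩ := hd
  refine ⟨addOrderOf a, Nat.pos_of_ne_zero ha, fun b hb => ?_⟩
  obtain ⟨n, rfl⟩ := AddSubgroup.mem_zmultiples_iff.1 hb
  rw [smul_comm, addOrderOf_nsmul_eq_zero, smul_zero]

section SkewProduct

variable {X : Type*} {T : X → X} {ψ : X → AddCircle (1 : ℝ)}

theorem continuous_skewProd [TopologicalSpace X] (hT : Continuous T) (hψ : Continuous ψ) :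
    Continuous (skewProd T ψ) := by
  unfold skewProd
  fun_prop

theorem skewProd_iterate_fst (n : ℕ) (p : X × AddCircle (1 : ℝ)) :
    ((skewProd T ψ)^[n] p).1 = T^[n] p.1 :=
  (show Function.Semiconj Prod.fst (skewProd T ψ) T from fun _ => rfl).iterate_right n p

/-- Translation by `α` in the fibres. -/
def fibreTranslate (α : AddCircle (1 : ℝ)) (p : X × AddCircle (1 : ℝ)) :
    X × AddCircle (1 : ℝ) :=
  (p.1, p.2 + α)

theorem fibreTranslate_skewProd (α : AddCircle (1 : ℝ)) (p : X × AddCircle (1 : ℝ)) :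
    fibreTranslate α (skewProd T ψ p) = skewProd T ψ (fibreTranslate α p) :=
  Prod.ext rfl (add_right_comm _ _ _)

theorem fibreTranslate_skewProd_iterate (α : AddCircle (1 : ℝ)) (n : ℕ)
    (p : X × AddCircle (1 : ℝ)) :
    fibreTranslate α ((skewProd T ψ)^[n] p) = (skewProd T ψ)^[n] (fibreTranslate α p) :=
  (show Function.Semiconj (fibreTranslate α) (skewProd T ψ) (skewProd T ψ) from
    fibreTranslate_skewProd α).iterate_right n p

theorem continuous_fibreTranslate [TopologicalSpace X] (α : AddCircle (1 : ℝ)) :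
    Continuous (fibreTranslate (X := X) α) := by
  unfold fibreTranslate
  fun_prop

/-- A fibre translation sending one point of a minimal set into that set preserves the set. -/
theorem fibreTranslate_mem_of_minimal [TopologicalSpace X] {M : Set (X × AddCircle (1 : ℝ))}
    (hM : Minimal (IsClosedInvariant (skewProd T ψ)) M) {α : AddCircle (1 : ℝ)}
    {w z : X × AddCircle (1 : ℝ)} (hw : w ∈ M) (hwα : fibreTranslate α w ∈ M) (hz : z ∈ M) :
    fibreTranslate α z ∈ M := by
  have hA : IsClosedInvariant (skewProd T ψ) (M ∩ fibreTranslate α ⁻¹' M) := by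
    refine ⟨hM.prop.1.inter (hM.prop.1.preimage (continuous_fibreTranslate α)), ⟨w, hw, hwα⟩,
      fun y hy => ⟨hM.prop.2.2 hy.1, ?_⟩⟩
    rw [Set.mem_preimage, fibreTranslate_skewProd]
    exact hM.prop.2.2 hy.2
  exact (hM.2 hA Set.inter_subset_left hz).2

/-- The group of fibre translations preserving a minimal set of the skew product. -/
def fibreStabilizer [TopologicalSpace X] {M : Set (X × AddCircle (1 : ℝ))}
    (hM : Minimal (IsClosedInvariant (skewProd T ψ)) M) : AddSubgroup (AddCircle (1 : ℝ)) where
  carrier := {α | ∀ z ∈ M, fibreTranslate α z ∈ M}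
  zero_mem' z hz := by simpa [fibreTranslate] using hz
  add_mem' {a b} ha hb z hz := by
    simpa [fibreTranslate, add_assoc] using hb _ (ha z hz)
  neg_mem' {a} ha z hz := by
    obtain ⟨w, hw⟩ := hM.prop.2.1
    exact fibreTranslate_mem_of_minimal hM (ha w hw) (by simpa [fibreTranslate] using hw) hz

theorem isClosed_fibreStabilizer [TopologicalSpace X] {M : Set (X × AddCircle (1 : ℝ))}
    (hM : Minimal (IsClosedInvariant (skewProd T ψ)) M) :
    IsClosed (fibreStabilizer hM : Set (AddCircle (1 : ℝ))) := by
  have : (fibreStabilizer hM : Set (AddCircle (1 : ℝ))) =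
      ⋂ z ∈ M, (fun α => fibreTranslate α z) ⁻¹' M := by
    ext α
    simp [fibreStabilizer]
  rw [this]
  refine isClosed_biInter fun z _ => hM.prop.1.preimage ?_
  unfold fibreTranslate
  fun_prop

theorem sub_mem_fibreStabilizer [TopologicalSpace X] {M : Set (X × AddCircle (1 : ℝ))}
    (hM : Minimal (IsClosedInvariant (skewProd T ψ)) M) {p q : X × AddCircle (1 : ℝ)}
    (hp : p ∈ M) (hq : q ∈ M) (hpq : p.1 = q.1) : q.2 - p.2 ∈ fibreStabilizer hM := by
  have hqp : fibreTranslate (q.2 - p.2) p = q := Prod.ext hpq (add_sub_cancel _ _)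
  exact fun z hz => fibreTranslate_mem_of_minimal hM hp (hqp.symm ▸ hq) hz

/-- A solution of the cohomology equation makes the skew product equicontinuous. -/
theorem equicontinuous_skewProd_iterate [MetricSpace X] [CompactSpace X]
    (hequi : Equicontinuous fun n : ℕ => T^[n]) (hψ : Continuous ψ) {h : ℕ} (hh : 0 < h)
    {ξ : X → AddCircle (1 : ℝ)} (hξ : Continuous ξ)
    (hcoh : ∀ x, h • ψ x = ξ (T x) - ξ x) :
    Equicontinuous fun n : ℕ => (skewProd T ψ)^[n] := by
  have hh' : (0 : ℝ) < h := by exact_mod_cast hh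
  refine UniformEquicontinuous.equicontinuous (Metric.uniformEquicontinuous_iff.2 fun ε hε => ?_)
  obtain ⟨ε', hε', hε'ε, hε'h⟩ : ∃ ε' > 0, ε' ≤ ε ∧ ε' ≤ 1 / (4 * (h : ℝ)) :=
    ⟨min ε (1 / (4 * h)), lt_min hε (by positivity), min_le_left _ _, min_le_right _ _⟩
  obtain ⟨δξ, hδξ, hξδ⟩ := Metric.uniformContinuous_iff.1
    (CompactSpace.uniformContinuous_of_continuous hξ) (h * (ε' / 3)) (by positivity)
  obtain ⟨δψ, hδψ, hψδ⟩ := Metric.uniformContinuous_iff.1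
    (CompactSpace.uniformContinuous_of_continuous hψ) (1 / (4 * h)) (by positivity)
  obtain ⟨δ, hδ, hTδ⟩ := Metric.uniformEquicontinuous_iff.1
    (CompactSpace.uniformEquicontinuous_of_equicontinuous hequi)
    (min ε (min δξ δψ)) (by positivity)
  refine ⟨min δ (ε' / 3), by positivity, fun p q hpq => ?_⟩
  have hfst : dist p.1 q.1 < δ := (le_max_left _ _).trans_lt (hpq.trans_le (min_le_left _ _))
  have hsnd : dist p.2 q.2 < ε' / 3 :=
    (le_max_right _ _).trans_lt (hpq.trans_le (min_le_right _ _))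
  have hTn (n : ℕ) : dist ((skewProd T ψ)^[n] p).1 ((skewProd T ψ)^[n] q).1 <
      min ε (min δξ δψ) := by
    rw [skewProd_iterate_fst, skewProd_iterate_fst]
    exact hTδ _ _ hfst n
  have hinv (n : ℕ) (r : X × AddCircle (1 : ℝ)) :
      h • ((skewProd T ψ)^[n] r).2 = h • r.2 - ξ r.1 + ξ ((skewProd T ψ)^[n] r).1 := by
    induction n with
    | zero => simp
    | succ n ih =>
      rw [Function.iterate_succ_apply']
      simp only [skewProd] at ih ⊢
      rw [smul_add, ih, hcoh]
      abel
  have hξn (n : ℕ) : ‖ξ ((skewProd T ψ)^[n] p).1 - ξ ((skewProd T ψ)^[n] q).1‖ <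
      h * (ε' / 3) := by
    rw [← dist_eq_norm]
    exact hξδ ((hTn n).trans_le ((min_le_right _ _).trans (min_le_left _ _)))
  have hsmul (n : ℕ) :
      ‖h • (((skewProd T ψ)^[n] p).2 - ((skewProd T ψ)^[n] q).2)‖ < h * ε' := by
    have hsplit : h • (((skewProd T ψ)^[n] p).2 - ((skewProd T ψ)^[n] q).2) =
        h • (p.2 - q.2) - (ξ p.1 - ξ q.1) +
          (ξ ((skewProd T ψ)^[n] p).1 - ξ ((skewProd T ψ)^[n] q).1) := by
      rw [smul_sub, hinv, hinv, smul_sub]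
      abel
    rw [hsplit]
    have h1 : ‖h • (p.2 - q.2)‖ ≤ h * ‖p.2 - q.2‖ := norm_nsmul_le
    have h2 : h * ‖p.2 - q.2‖ < h * (ε' / 3) := by
      rw [← dist_eq_norm]
      gcongr
    have h3 := hξn 0
    have h4 := hξn n
    have h5 := norm_add_le (h • (p.2 - q.2) - (ξ p.1 - ξ q.1))
      (ξ ((skewProd T ψ)^[n] p).1 - ξ ((skewProd T ψ)^[n] q).1)
    have h6 := norm_sub_le (h • (p.2 - q.2)) (ξ p.1 - ξ q.1)
    simp only [Function.iterate_zero, id_eq] at h3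
    linarith
  have hmain (n : ℕ) : ‖((skewProd T ψ)^[n] p).2 - ((skewProd T ψ)^[n] q).2‖ < ε' := by
    induction n with
    | zero =>
      rw [← dist_eq_norm]
      exact hsnd.trans (by linarith)
    | succ n ih =>
      have hstep : ‖((skewProd T ψ)^[n + 1] p).2 - ((skewProd T ψ)^[n + 1] q).2‖ ≤
          1 / (2 * h) := by
        have hψn : ‖ψ ((skewProd T ψ)^[n] p).1 - ψ ((skewProd T ψ)^[n] q).1‖ <
            1 / (4 * h) := by
          rw [← dist_eq_norm]
          exact hψδ ((hTn n).trans_le ((min_le_right _ _).trans (min_le_right _ _)))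
        rw [Function.iterate_succ_apply', Function.iterate_succ_apply']
        have hadd := norm_add_le (((skewProd T ψ)^[n] p).2 - ((skewProd T ψ)^[n] q).2)
          (ψ ((skewProd T ψ)^[n] p).1 - ψ ((skewProd T ψ)^[n] q).1)
        have hhalf : 1 / (2 * (h : ℝ)) = 1 / (4 * h) + 1 / (4 * h) := by
          field_simp
          norm_num
        rw [← add_sub_add_comm] at hadd
        exact hadd.trans (by linarith)
      have := hsmul (n + 1)
      rw [AddCircle.norm_nsmul_eq_of_norm_le hh hstep] at this
      exact lt_of_mul_lt_mul_left this hh'.le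
  intro n
  refine max_lt ((hTn n).trans_le (min_le_left _ _)) ?_
  rw [dist_eq_norm]
  exact (hmain n).trans_le hε'ε

/-- A minimal set projecting onto `X`, with fibre stabilizer annihilated by `h`, is the
level set of a solution of the cohomology equation. -/
theorem exists_cohomology_solution [TopologicalSpace X] [CompactSpace X] [T2Space X]
    {M : Set (X × AddCircle (1 : ℝ))} (hM : Minimal (IsClosedInvariant (skewProd T ψ)) M)
    (hsurj : ∀ x, ∃ θ, (x, θ) ∈ M) {h : ℕ} (hh : ∀ a ∈ fibreStabilizer hM, h • a = 0) :
    ∃ ξ : X → AddCircle (1 : ℝ), Continuous ξ ∧ ∀ x, h • ψ x = ξ (T x) - ξ x := by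
  choose θ hθ using hsurj
  have hconst {p : X × AddCircle (1 : ℝ)} (hp : p ∈ M) : h • θ p.1 = h • p.2 := by
    rw [← sub_eq_zero, ← smul_sub]
    exact hh _ (sub_mem_fibreStabilizer hM hp (hθ p.1) rfl)
  refine ⟨fun x => h • θ x, ?_, fun x => ?_⟩
  · have : CompactSpace M := isCompact_iff_compactSpace.1 hM.prop.1.isCompact
    have hcont : Continuous fun p : M => (p : X × AddCircle (1 : ℝ)).1 := by fun_prop
    have hq : Topology.IsQuotientMap fun p : M => (p : X × AddCircle (1 : ℝ)).1 :=
      hcont.isClosedMap.isQuotientMap hcont fun x => ⟨⟨_, hθ x⟩, rfl⟩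
    rw [hq.continuous_iff]
    have hcomp : ((fun x => h • θ x) ∘ fun p : M => (p : X × AddCircle (1 : ℝ)).1) =
        fun p : M => h • (p : X × AddCircle (1 : ℝ)).2 := funext fun p => hconst p.2
    rw [hcomp]
    fun_prop
  · have := hconst (hM.prop.2.2 (hθ x))
    simp only [skewProd, smul_add] at this
    exact eq_sub_of_add_eq' this.symm

end SkewProduct

/-- `𝕋`-extensions of equicontinuous minimal systems: if `(X, T)` is a minimal system on
a nonempty compact metric space with `{Tⁿ}` equicontinuous and `ψ : X → ℝ/ℤ` is
continuous, then the skew product `T_ψ` is either minimal, or else `{T_ψⁿ}` is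
equicontinuous, every point of `X × ℝ/ℤ` is uniformly recurrent (hence Bohr almost
periodic) for `T_ψ`, and the cohomology equation `h•ψ = ξ∘T − ξ` admits a solution with
`h ∈ ℕ`, `h > 0`, and `ξ : X → ℝ/ℤ` continuous. -/
theorem skew_product_dichotomy {X : Type*} [MetricSpace X] [CompactSpace X] [Nonempty X]
    (T : X → X) (hT : Continuous T)
    (hmin : ∀ Y : Set X, IsClosed Y → Y.Nonempty → Set.MapsTo T Y Y → Y = Set.univ)
    (hequi : Equicontinuous fun n : ℕ => T^[n])
    (ψ : X → AddCircle (1 : ℝ)) (hψ : Continuous ψ) :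
    (∀ Z : Set (X × AddCircle (1 : ℝ)), IsClosed Z → Z.Nonempty →
        Set.MapsTo (skewProd T ψ) Z Z → Z = Set.univ) ∨
      ((Equicontinuous fun n : ℕ => (skewProd T ψ)^[n]) ∧
        (∀ p : X × AddCircle (1 : ℝ), ∀ U : Set (X × AddCircle (1 : ℝ)),
          IsOpen U → p ∈ U → SyndeticNat {n : ℕ | (skewProd T ψ)^[n] p ∈ U}) ∧
        ∃ h : ℕ, 0 < h ∧ ∃ ξ : X → AddCircle (1 : ℝ), Continuous ξ ∧
          ∀ x : X, h • ψ x = ξ (T x) - ξ x) := by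
  refine or_iff_not_imp_left.2 fun hnot => ?_
  push Not at hnot
  obtain ⟨Z, hZcl, hZne, hZinv, hZ⟩ := hnot
  obtain ⟨M, hMZ, hM⟩ := IsClosedInvariant.exists_minimal_subset
    (S := skewProd T ψ) ⟨hZcl, hZne, hZinv⟩
  have hsurj (x : X) : ∃ θ, (x, θ) ∈ M := by
    have himage : Prod.fst '' M = Set.univ :=
      hmin _ (hM.prop.1.isCompact.image continuous_fst).isClosed (hM.prop.2.1.image _) <| by
        rintro _ ⟨p, hp, rfl⟩
        exact ⟨_, hM.prop.2.2 hp, rfl⟩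
    obtain ⟨⟨_, θ⟩, hp, rfl⟩ := himage.ge (Set.mem_univ x)
    exact ⟨θ, hp⟩
  have hproper : fibreStabilizer hM ≠ ⊤ := by
    intro htop
    refine hZ (Set.eq_univ_of_forall fun p => hMZ ?_)
    obtain ⟨θ, hθ⟩ := hsurj p.1
    have hmem : p.2 - θ ∈ fibreStabilizer hM := htop ▸ AddSubgroup.mem_top _
    simpa [fibreTranslate] using hmem _ hθ
  obtain ⟨h, hh, hann⟩ :=
    AddCircle.exists_nsmul_eq_zero_of_isClosed (isClosed_fibreStabilizer hM) hproper
  obtain ⟨ξ, hξ, hcoh⟩ := exists_cohomology_solution hM hsurj hann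
  refine ⟨equicontinuous_skewProd_iterate hequi hψ hh hξ hcoh, fun p U hU hp => ?_,
    h, hh, ξ, hξ, hcoh⟩
  obtain ⟨θ, hθ⟩ := hsurj p.1
  have hpθ : fibreTranslate (p.2 - θ) (p.1, θ) = p := Prod.ext rfl (add_sub_cancel _ _)
  have hsynd := syndeticNat_of_minimal (continuous_skewProd hT hψ) hM
    (hU.preimage (continuous_fibreTranslate (p.2 - θ))) ⟨_, hθ, by rwa [Set.mem_preimage, hpθ]⟩ hθ
  simpa only [Set.mem_preimage, fibreTranslate_skewProd_iterate, hpθ] using hsynd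
end
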